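/- Let X be a regular curve and f : X → X a homeomorphism with at least one wandering point. Then for every n ≥ 1 the induced map F_n(f) on the n-fold symmetric product satisfies h_pol(F_n(f)) = n. -/

import Mathlib

open Filter Topology TopologicalSpace Set
open scoped ENNReal NNReal

variable {X : Type*}

/-- The dynamical (Bowen) distance `d_n^f(x,y) = max_{0 ≤ k ≤ n-1} d(f^k x, f^k y)`. -/
noncomputable def dynDist [PseudoMetricSpace X] (f : X → X) (n : ℕ) (x y : X) : ℝ :=
  (((Finset.range n).sup fun k => nndist (f^[k] x) (f^[k] y) : ℝ≥0) : ℝ)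

/-- `E` is `(n, ε)`-separated for `f`: distinct points of `E` are at `d_n^f`-distance `≥ ε`. -/
def IsDynSeparated [PseudoMetricSpace X] (f : X → X) (n : ℕ) (ε : ℝ) (E : Set X) : Prop :=
  ∀ x ∈ E, ∀ y ∈ E, x ≠ y → ε ≤ dynDist f n x y

/-- `sep(n, ε)`: the maximal cardinality of a finite `(n, ε)`-separated set. -/
noncomputable def sepCount [PseudoMetricSpace X] (f : X → X) (n : ℕ) (ε : ℝ) : ℕ∞ :=
  ⨆ (E : Finset X) (_ : IsDynSeparated f n ε (E : Set X)), (E.card : ℕ∞)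

/-- `limsup_{n → ∞} log (u n) / log n`, valued in `[0, ∞]`. -/
noncomputable def polGrowth (u : ℕ → ℕ∞) : ℝ≥0∞ :=
  Filter.atTop.limsup fun n =>
    if u n = ⊤ then ⊤ else ENNReal.ofReal (Real.log ((u n).toNat : ℝ) / Real.log n)

/-- Polynomial entropy: `lim_{ε → 0⁺} limsup_{n → ∞} log sep(n,ε) / log n`; since the inner
quantity is antitone in `ε`, the limit as `ε → 0⁺` equals the supremum over `ε > 0`. -/
noncomputable def hpol [PseudoMetricSpace X] (f : X → X) : ℝ≥0∞ :=
  ⨆ (ε : ℝ) (_ : 0 < ε), polGrowth fun n => sepCount f n ε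

/-- The regularity condition for a regular curve: every point has arbitrarily small open
neighbourhoods with finite topological boundary. (The requirement that `X` be a continuum,
i.e. a nonempty compact connected metric space, is imposed via instance arguments.) -/
def IsRegularCurve (X : Type*) [TopologicalSpace X] : Prop :=
  ∀ x : X, ∀ U : Set X, IsOpen U → x ∈ U →
    ∃ V : Set X, IsOpen V ∧ x ∈ V ∧ V ⊆ U ∧ (frontier V).Finite

/-- A wandering point: some open neighbourhood `U` of `p` satisfies `f^n(U) ∩ U = ∅` for all
`n ≥ 1`. -/
def IsWanderingPoint [TopologicalSpace X] (f : X → X) (p : X) : Prop :=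
  ∃ U : Set X, IsOpen U ∧ p ∈ U ∧ ∀ n : ℕ, 1 ≤ n → f^[n] '' U ∩ U = ∅

/-- The induced map `2^f : A ↦ f(A)` on the hyperspace of nonempty closed subsets of a compact
metric space (equivalently, nonempty compact subsets), with the Hausdorff metric. -/
noncomputable def hyperMap [TopologicalSpace X] (f : X → X) (hf : Continuous f) :
    NonemptyCompacts X → NonemptyCompacts X :=
  fun A => ⟨⟨f '' (A : Set X), A.isCompact.image hf⟩, A.nonempty.image f⟩

/-- The `n`-fold symmetric product `F_n(X)`: nonempty subsets of `X` of cardinality at most `n`,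
as a metric subspace of the hyperspace `2^X` with the Hausdorff metric. -/
abbrev SymmProd (X : Type*) [MetricSpace X] (n : ℕ) : Type _ :=
  {A : NonemptyCompacts X // (A : Set X).encard ≤ n}

/-- The induced map `F_n(f) : F_n(X) → F_n(X)`, `A ↦ f(A)`. -/
noncomputable def symmMap [MetricSpace X] (f : X → X) (hf : Continuous f) (n : ℕ) :
    SymmProd X n → SymmProd X n :=
  fun A => ⟨hyperMap f hf A.1, le_trans (Set.encard_image_le f (A.1 : Set X)) A.2⟩

theorem dynDist_le [PseudoMetricSpace X] {f : X → X} {m : ℕ} {x y : X} {r : ℝ} (hr : 0 ≤ r)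
    (h : ∀ k < m, dist (f^[k] x) (f^[k] y) ≤ r) : dynDist f m x y ≤ r := by
  lift r to ℝ≥0 using hr
  refine NNReal.coe_le_coe.2 (Finset.sup_le fun k hk => ?_)
  exact_mod_cast h k (Finset.mem_range.1 hk)

theorem dist_iterate_le_dynDist [PseudoMetricSpace X] (f : X → X) {m k : ℕ} (hk : k < m)
    (x y : X) : dist (f^[k] x) (f^[k] y) ≤ dynDist f m x y := by
  rw [← coe_nndist]
  exact NNReal.coe_le_coe.2
    (Finset.le_sup (f := fun k => nndist (f^[k] x) (f^[k] y)) (Finset.mem_range.2 hk))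

/-- A uniformly separated finite family bounds `sepCount` from below. -/
theorem card_le_sepCount [PseudoMetricSpace X] {f : X → X} {m : ℕ} {ε : ℝ} (hε : 0 < ε)
    {ι : Type*} [Fintype ι] (y : ι → X)
    (hy : ∀ i j, i ≠ j → ∃ k < m, ε ≤ dist (f^[k] (y i)) (f^[k] (y j))) :
    (Fintype.card ι : ℕ∞) ≤ sepCount f m ε := by
  have hinj : Function.Injective y := by
    intro i j hij
    by_contra hne
    obtain ⟨k, -, hk⟩ := hy i j hne
    rw [hij, dist_self] at hk
    exact hk.not_gt hε
  refine le_iSup₂_of_le (Finset.univ.map ⟨y, hinj⟩) ?_ (by simp)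
  intro a ha b hb hab
  simp only [Finset.coe_map, Function.Embedding.coeFn_mk, Finset.coe_univ, image_univ,
    mem_range] at ha hb
  obtain ⟨i, rfl⟩ := ha
  obtain ⟨j, rfl⟩ := hb
  obtain ⟨k, hkm, hk⟩ := hy i j (fun h => hab (congrArg y h))
  exact hk.trans (dist_iterate_le_dynDist f hkm _ _)

/-- A finite family of `d_m`-centres of radius `r < ε / 2` bounds `sepCount` from above. -/
theorem sepCount_le_card [PseudoMetricSpace X] {f : X → X} {m : ℕ} {ε r : ℝ} (hr : 0 ≤ r)
    (hrε : 2 * r < ε) {ι : Type*} [Fintype ι] (z : ι → X)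
    (hz : ∀ x, ∃ i, ∀ k < m, dist (f^[k] x) (f^[k] (z i)) ≤ r) :
    sepCount f m ε ≤ Fintype.card ι := by
  choose c hc using hz
  refine iSup₂_le fun E hE => ?_
  rw [← Finset.card_univ]
  refine Nat.cast_le.2 (Finset.card_le_card_of_injOn c (fun _ _ => by simp) ?_)
  intro x hx y hy hxy
  by_contra hne
  refine (hE x hx y hy hne).not_gt (lt_of_le_of_lt ?_ hrε)
  refine dynDist_le (by positivity) fun k hk => ?_
  have h₁ := hc x k hk
  have h₂ := hc y k hk
  rw [← hxy] at h₂
  linarith [dist_triangle_right (f^[k] x) (f^[k] y) (f^[k] (z (c x)))]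

theorem tendsto_log_const_mul_pow_div_log (c : ℝ) (N : ℕ) :
    Tendsto (fun m : ℕ => ENNReal.ofReal ((c + N * Real.log m) / Real.log m)) atTop
      (𝓝 (N : ℝ≥0∞)) := by
  have hlog : Tendsto (fun m : ℕ => Real.log m) atTop atTop :=
    Real.tendsto_log_atTop.comp tendsto_natCast_atTop_atTop
  have h : Tendsto (fun m : ℕ => c / Real.log m + N) atTop (𝓝 (0 + N)) :=
    (hlog.const_div_atTop c).add_const _
  have h' : Tendsto (fun m : ℕ => (c + N * Real.log m) / Real.log m) atTop (𝓝 (N : ℝ)) := by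
    rw [zero_add] at h
    refine h.congr' ?_
    filter_upwards [hlog.eventually_gt_atTop 0] with m hm
    field_simp
  simpa using ENNReal.tendsto_ofReal h'

/-- A bound `u m ≤ K m ^ N` gives polynomial growth at most `N`. -/
theorem polGrowth_le_of_le_mul_pow {u : ℕ → ℕ∞} {K N : ℕ} (hK : K ≠ 0)
    (h : ∀ᶠ m in atTop, u m ≤ ((K * m ^ N : ℕ) : ℕ∞)) : polGrowth u ≤ N := by
  rw [← (tendsto_log_const_mul_pow_div_log (Real.log K) N).limsup_eq]
  refine limsup_le_limsup ?_
  filter_upwards [h, eventually_ge_atTop 2] with m hm hm2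
  obtain ⟨a, ha⟩ := ENat.ne_top_iff_exists.1 (ne_top_of_le_ne_top (ENat.natCast_ne_top _) hm)
  rw [← ha] at hm ⊢
  rw [if_neg (ENat.natCast_ne_top _), ENat.toNat_natCast]
  have hm0 : (m : ℝ) ≠ 0 := by positivity
  have hlog : 0 < Real.log m := Real.log_pos (by exact_mod_cast hm2)
  refine ENNReal.ofReal_le_ofReal (div_le_div_of_nonneg_right ?_ hlog.le)
  rw [← Real.log_pow, ← Real.log_mul (by exact_mod_cast hK) (pow_ne_zero _ hm0)]
  rcases Nat.eq_zero_or_pos a with rfl | ha0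
  · have : 1 ≤ K * m ^ N := Nat.one_le_iff_ne_zero.2 (by positivity)
    simpa using Real.log_nonneg (show (1 : ℝ) ≤ K * (m : ℝ) ^ N by exact_mod_cast this)
  · exact Real.log_le_log (by exact_mod_cast ha0) (by exact_mod_cast hm)

/-- A bound `m ^ N ≤ K u m` gives polynomial growth at least `N`. -/
theorem le_polGrowth_of_pow_le_mul {u : ℕ → ℕ∞} {K N : ℕ} (hK : K ≠ 0)
    (h : ∀ᶠ m in atTop, ((m ^ N : ℕ) : ℕ∞) ≤ K * u m) : N ≤ polGrowth u := by
  rw [← (tendsto_log_const_mul_pow_div_log (-Real.log K) N).limsup_eq]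
  refine limsup_le_limsup ?_
  filter_upwards [h, eventually_ge_atTop 2] with m hm hm2
  split_ifs with htop
  · exact le_top
  obtain ⟨a, ha⟩ := ENat.ne_top_iff_exists.1 htop
  rw [← ha] at hm ⊢
  rw [ENat.toNat_natCast]
  have hm' : m ^ N ≤ K * a := by exact_mod_cast hm
  have hm0 : 0 < m := by positivity
  have ha0 : a ≠ 0 := by
    rintro rfl
    exact (pow_pos hm0 N).not_ge hm'
  have hlog : 0 < Real.log m := Real.log_pos (by exact_mod_cast hm2)
  refine ENNReal.ofReal_le_ofReal (div_le_div_of_nonneg_right ?_ hlog.le)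
  rw [neg_add_le_iff_le_add, ← Real.log_pow,
    ← Real.log_mul (by exact_mod_cast hK) (by exact_mod_cast ha0)]
  exact Real.log_le_log (by positivity) (by exact_mod_cast hm')

/-- On a regular curve, linearly many points suffice to `d_m`-span up to `r` for an injective
continuous map. -/
theorem IsRegularCurve.exists_linear_span [MetricSpace X] [CompactSpace X] [ConnectedSpace X]
    (hX : IsRegularCurve X) {f : X → X} (hf : Continuous f) (hinj : Function.Injective f)
    {r : ℝ} (hr : 0 < r) :
    ∃ C : ℕ, ∀ m : ℕ, ∃ T : Finset X, T.card ≤ C * m + 1 ∧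
      ∀ x, ∃ b ∈ T, ∀ k < m, dist (f^[k] x) (f^[k] b) ≤ r := by
  classical
  choose V hVo hxV hVb hVf using fun x : X =>
    hX x (Metric.ball x (r / 2)) Metric.isOpen_ball (Metric.mem_ball_self (by positivity))
  obtain ⟨t, ht⟩ := isCompact_univ.elim_finite_subcover V hVo
    (fun x _ => mem_iUnion.2 ⟨x, hxV x⟩)
  have hcov : ∀ x, ∃ c ∈ t, x ∈ V c := fun x => by simpa using ht (mem_univ x)
  choose c hct hc using hcov
  have hclose : ∀ x y c, x ∈ V c → y ∈ closure (V c) → dist x y ≤ r := by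
    intro x y c hx hy
    have h₁ : dist x c < r / 2 := hVb c hx
    have h₂ : dist y c ≤ r / 2 := closure_minimal ((hVb c).trans Metric.ball_subset_closedBall)
      Metric.isClosed_closedBall hy
    linarith [dist_triangle_right x y c]
  let B : Finset X := t.biUnion fun c => (hVf c).toFinset
  obtain ⟨x₀⟩ : Nonempty X := inferInstance
  refine ⟨B.card, fun m => ⟨insert x₀ ((Finset.range m).biUnion fun k =>
    B.preimage f^[k] (hinj.iterate k).injOn), ?_, fun x => ?_⟩⟩
  · refine (Finset.card_insert_le _ _).trans (Nat.succ_le_succ ?_)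
    refine (Finset.card_biUnion_le_card_mul _ _ B.card fun k _ => ?_).trans ?_
    · exact Finset.card_le_card_of_injOn f^[k] (fun y hy => by simpa using hy)
        (hinj.iterate k).injOn
    · rw [Finset.card_range, mul_comm]
  let D : Set X := ⋂ k ∈ Finset.range m, f^[k] ⁻¹' V (c (f^[k] x))
  have hDo : IsOpen D :=
    isOpen_biInter_finset fun k _ => (hVo _).preimage (hf.iterate k)
  have hxD : x ∈ D := mem_iInter₂.2 fun k _ => hc _
  by_cases hD : D = univ
  · refine ⟨x₀, Finset.mem_insert_self _ _, fun k hk => ?_⟩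
    have hx₀ : x₀ ∈ D := hD ▸ mem_univ _
    exact hclose _ _ _ (hc _)
      (subset_closure (mem_iInter₂.1 hx₀ k (Finset.mem_range.2 hk)))
  · obtain ⟨b, hb⟩ := nonempty_frontier_iff.2 ⟨⟨x, hxD⟩, hD⟩
    rw [hDo.frontier_eq] at hb
    have hcl : ∀ k < m, f^[k] b ∈ closure (V (c (f^[k] x))) := fun k hk =>
      map_mem_closure (hf.iterate k) hb.1
        fun y hy => mem_iInter₂.1 hy k (Finset.mem_range.2 hk)
    obtain ⟨k, hk, hbk⟩ : ∃ k < m, f^[k] b ∉ V (c (f^[k] x)) := by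
      simpa [D] using hb.2
    refine ⟨b, Finset.mem_insert_of_mem (Finset.mem_biUnion.2 ⟨k, Finset.mem_range.2 hk, ?_⟩),
      fun j hj => hclose _ _ _ (hc _) (hcl j hj)⟩
    simp only [Finset.mem_preimage, B, Finset.mem_biUnion, Finite.mem_toFinset]
    exact ⟨_, hct _, by rw [(hVo _).frontier_eq]; exact ⟨hcl k hk, hbk⟩⟩

theorem coe_symmMap_iterate [MetricSpace X] {f : X → X} (hf : Continuous f) (n k : ℕ)
    (A : SymmProd X n) :
    ((((symmMap f hf n)^[k] A).1 : NonemptyCompacts X) : Set X) = f^[k] '' (A.1 : Set X) := by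
  induction k with
  | zero => simp
  | succ k ih =>
    rw [Function.iterate_succ_apply', Function.iterate_succ', image_comp, ← ih]
    rfl

/-- The point of the symmetric product given by the values of an `n`-tuple. -/
def SymmProd.ofTuple [MetricSpace X] {n : ℕ} (hn : 1 ≤ n) (a : Fin n → X) : SymmProd X n :=
  ⟨⟨⟨range a, (finite_range a).isCompact⟩, ⟨a ⟨0, hn⟩, mem_range_self _⟩⟩, by
    change (range a).encard ≤ n
    rw [← image_univ]
    exact (encard_image_le a univ).trans (by simp)⟩

theorem SymmProd.exists_range_eq [MetricSpace X] {n : ℕ} (A : SymmProd X n) :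
    ∃ a : Fin n → X, range a = (A.1 : Set X) := by
  have hfin : (A.1 : Set X).Finite := finite_of_encard_le_coe A.2
  have : Nonempty (A.1 : Set X) := A.1.nonempty.to_subtype
  have := hfin.fintype
  obtain ⟨e⟩ : Nonempty ((A.1 : Set X) ↪ Fin n) := by
    refine Function.Embedding.nonempty_of_card_le ?_
    have h := A.2
    rw [encard_eq_coe_toFinset_card] at h
    simpa [toFinset_card] using h
  refine ⟨Subtype.val ∘ Function.invFun e, ?_⟩
  rw [(Function.invFun_surjective e.injective).range_comp, Subtype.range_coe]

theorem hpol_symmMap_le [MetricSpace X] [CompactSpace X] [ConnectedSpace X]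
    (hX : IsRegularCurve X) {f : X → X} (hf : Continuous f) (hinj : Function.Injective f)
    {n : ℕ} (hn : 1 ≤ n) : hpol (symmMap f hf n) ≤ n := by
  refine iSup₂_le fun ε hε => ?_
  obtain ⟨C, hC⟩ := hX.exists_linear_span hf hinj (show 0 < ε / 3 by positivity)
  refine polGrowth_le_of_le_mul_pow (K := (C + 1) ^ n) (by positivity) ?_
  filter_upwards [eventually_ge_atTop 1] with m hm
  obtain ⟨T, hT, hspan⟩ := hC m
  choose b hbT hb using hspan
  have key : sepCount (symmMap f hf n) m ε ≤ Fintype.card (Fin n → T) := by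
    refine sepCount_le_card (r := ε / 3) (by positivity) (by linarith)
      (fun g => SymmProd.ofTuple hn fun i => (g i : X)) fun A => ?_
    obtain ⟨a, ha⟩ := A.exists_range_eq
    refine ⟨fun i => ⟨b (a i), hbT _⟩, fun k hk => ?_⟩
    rw [Subtype.dist_eq, Metric.NonemptyCompacts.dist_eq, coe_symmMap_iterate, coe_symmMap_iterate, ← ha]
    change Metric.hausdorffDist (f^[k] '' range a) (f^[k] '' range fun i => b (a i)) ≤ ε / 3
    refine Metric.hausdorffDist_le_of_mem_dist (by positivity) ?_ ?_
    · rintro _ ⟨_, ⟨i, rfl⟩, rfl⟩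
      exact ⟨_, ⟨_, ⟨i, rfl⟩, rfl⟩, hb _ k hk⟩
    · rintro _ ⟨_, ⟨i, rfl⟩, rfl⟩
      exact ⟨_, ⟨_, ⟨i, rfl⟩, rfl⟩, by rw [dist_comm]; exact hb _ k hk⟩
  refine key.trans (Nat.cast_le.2 ?_)
  rw [Fintype.card_fun, Fintype.card_coe, Fintype.card_fin, ← mul_pow]
  exact Nat.pow_le_pow_left (by nlinarith) n

/-- A surjection with a wandering point has a backward orbit of it whose points visit a fixed
neighbourhood only at their own hitting time. -/
theorem IsWanderingPoint.exists_backward_orbit [MetricSpace X] {f : X → X} {p : X}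
    (hp : IsWanderingPoint f p) (hsurj : Function.Surjective f) :
    ∃ ε > 0, ∃ x : ℕ → X, ∀ i j, i ≠ j → f^[i] (x i) = p ∧ ε ≤ dist p (f^[i] (x j)) := by
  obtain ⟨U, hU, hpU, hw⟩ := hp
  obtain ⟨ε, hε, hball⟩ := Metric.isOpen_iff.1 hU p hpU
  choose x hx using fun j : ℕ => hsurj.iterate j p
  refine ⟨ε, hε, x, fun i j hij => ⟨hx i, ?_⟩⟩
  by_contra! hlt
  have hmem : f^[i] (x j) ∈ U := hball (by rwa [Metric.mem_ball, dist_comm])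
  rcases hij.lt_or_gt with h | h
  · refine (hw (j - i) (by omega)).subset ⟨⟨_, hmem, ?_⟩, hpU⟩
    rw [← Function.iterate_add_apply, Nat.sub_add_cancel h.le, hx]
  · refine (hw (i - j) (by omega)).subset ⟨⟨p, hpU, ?_⟩, hmem⟩
    rw [← hx j, ← Function.iterate_add_apply, Nat.sub_add_cancel h.le]

theorem le_hpol_symmMap [MetricSpace X] {f : X → X} (hf : Continuous f)
    (hsurj : Function.Surjective f) {p : X} (hp : IsWanderingPoint f p)
    {n : ℕ} (hn : 1 ≤ n) : n ≤ hpol (symmMap f hf n) := by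
  obtain ⟨ε, hε, x, hx⟩ := hp.exists_backward_orbit hsurj
  refine le_iSup₂_of_le ε hε (le_polGrowth_of_pow_le_mul (K := 2 ^ n * n.factorial)
    (by positivity) ?_)
  filter_upwards [eventually_ge_atTop (2 * n)] with m hm
  have hbinom : m ^ n ≤ 2 ^ n * n.factorial * m.choose n := by
    have h₁ : m ^ n ≤ (2 * (m + 1 - n)) ^ n := Nat.pow_le_pow_left (by omega) n
    have h₂ : (m + 1 - n) ^ n ≤ n.factorial * m.choose n := by
      rw [← Nat.descFactorial_eq_factorial_mul_choose]
      exact Nat.pow_sub_le_descFactorial m n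
    rw [mul_pow] at h₁
    rw [mul_assoc]
    exact h₁.trans (Nat.mul_le_mul_left _ h₂)
  let S := Finset.powersetCard n (Finset.range m)
  have hcard : ∀ s : S, (s : Finset ℕ).card = n := fun s => (Finset.mem_powersetCard.1 s.2).2
  let y : S → SymmProd X n := fun s =>
    SymmProd.ofTuple hn fun i => x ((s : Finset ℕ).orderEmbOfFin (hcard s) i)
  have hyc : ∀ s : S, ((y s).1 : Set X) = x '' ((s : Finset ℕ) : Set ℕ) := by
    intro s
    change range (x ∘ (s : Finset ℕ).orderEmbOfFin (hcard s)) = _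
    rw [range_comp, Finset.range_orderEmbOfFin]
  have hsep : ∀ s t : S, ∀ i ∈ (s : Finset ℕ), i ∉ (t : Finset ℕ) →
      ε ≤ dist ((symmMap f hf n)^[i] (y s)) ((symmMap f hf n)^[i] (y t)) := by
    intro s t i his hit
    rw [Subtype.dist_eq, Metric.NonemptyCompacts.dist_eq]
    by_contra! hlt
    have hmem : p ∈ (((symmMap f hf n)^[i] (y s)).1 : Set X) := by
      rw [coe_symmMap_iterate, hyc]
      exact ⟨x i, ⟨i, his, rfl⟩, (hx i (i + 1) (by omega)).1⟩
    obtain ⟨q, hq, hpq⟩ := Metric.exists_dist_lt_of_hausdorffDist_lt hmem hlt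
      (Metric.hausdorffEDist_ne_top_of_nonempty_of_bounded (NonemptyCompacts.nonempty _)
        (NonemptyCompacts.nonempty _) (NonemptyCompacts.isCompact _).isBounded
        (NonemptyCompacts.isCompact _).isBounded)
    rw [coe_symmMap_iterate, hyc] at hq
    obtain ⟨_, ⟨j, hj, rfl⟩, rfl⟩ := hq
    exact hpq.not_ge (hx i j (by rintro rfl; exact hit hj)).2
  have key : (Fintype.card S : ℕ∞) ≤ sepCount (symmMap f hf n) m ε := by
    refine card_le_sepCount hε y fun s t hst => ?_
    obtain ⟨i, his, hit⟩ : ∃ i ∈ (s : Finset ℕ), i ∉ (t : Finset ℕ) := by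
      by_contra! hsub
      exact hst (Subtype.ext (Finset.eq_of_subset_of_card_le hsub (by rw [hcard, hcard])))
    exact ⟨i, Finset.mem_range.1 ((Finset.mem_powersetCard.1 s.2).1 his), hsep s t i his hit⟩
  rw [Fintype.card_coe, Finset.card_powersetCard, Finset.card_range] at key
  calc ((m ^ n : ℕ) : ℕ∞) ≤ ((2 ^ n * n.factorial * m.choose n : ℕ) : ℕ∞) := Nat.cast_le.2 hbinom
    _ = ((2 ^ n * n.factorial : ℕ) : ℕ∞) * (m.choose n : ℕ∞) := by push_cast; ring
    _ ≤ _ := by gcongr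

/-- if a homeomorphism `f` of a regular curve has a wandering point, then the
induced map `F_n(f)` on the `n`-fold symmetric product satisfies `h_pol(F_n(f)) = n`. -/
theorem hpol_symmMap_eq_of_isRegularCurve_of_wandering
    {X : Type*} [MetricSpace X] [CompactSpace X] [ConnectedSpace X] [Nonempty X]
    (hX : IsRegularCurve X) (f : X → X) (hf : IsHomeomorph f)
    (p : X) (hp : IsWanderingPoint f p) (n : ℕ) (hn : 1 ≤ n) :
    hpol (symmMap f hf.continuous n) = (n : ℝ≥0∞) := by
  exact le_antisymm (hpol_symmMap_le hX hf.continuous hf.injective hn)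
    (le_hpol_symmMap hf.continuous hf.surjective hp hn)
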